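/- Corollary 5.4 (a) (equation (37)): let q, h, a, σ, κ be a Frenet frame of a spacelike ruled surface of type M₊², let c : ℝ → ℝ³ be smooth with c'(s) = q(s) for all s, let R be a real constant, set c*(s) = c(s) + R a(s), and assume κ(s) ≠ 0 for all s. Then for all s the determinant det(c*'(s), a(s), a'(s)) is nonzero; that is, the trajectory ruled surface φ_{h*}(s,v) = c*(s) + v a(s), generated by the central normal h* = a of a Mannheim offset, is nondevelopable (its distribution parameter p_{h*} = -1/(σκ) never vanishes), even though φ is developable. -/

import Mathlib

noncomputable section

/-- The Minkowski bilinear form on ℝ³: ⟨x,y⟩ = -x₁y₁ + x₂y₂ + x₃y₃. -/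
def mink (x y : Fin 3 → ℝ) : ℝ := -(x 0 * y 0) + x 1 * y 1 + x 2 * y 2

/-- The Minkowski norm ‖v‖ = √|⟨v,v⟩|. -/
def mnorm (v : Fin 3 → ℝ) : ℝ := Real.sqrt |mink v v|

/-- The determinant of three vectors in ℝ³. -/
def det3 (u v w : Fin 3 → ℝ) : ℝ :=
  u 0 * (v 1 * w 2 - v 2 * w 1) - u 1 * (v 0 * w 2 - v 2 * w 0)
    + u 2 * (v 0 * w 1 - v 1 * w 0)

/-- A Frenet frame of a spacelike ruled surface of type M₊² in Minkowski 3-space: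
orthonormal fields `q` (spacelike ruling), `h` (timelike central normal),
`a` (spacelike asymptotic normal), with `σ = ds₁/ds > 0` and conical curvature `κ`,
satisfying the Frenet equations q' = σh, h' = σ(q + κa), a' = σκh. -/
structure FrenetFrameM2 where
  q : ℝ → Fin 3 → ℝ
  h : ℝ → Fin 3 → ℝ
  a : ℝ → Fin 3 → ℝ
  σ : ℝ → ℝ
  κ : ℝ → ℝ
  smooth_q : ContDiff ℝ (⊤ : ℕ∞) q
  smooth_h : ContDiff ℝ (⊤ : ℕ∞) h
  smooth_a : ContDiff ℝ (⊤ : ℕ∞) a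
  smooth_σ : ContDiff ℝ (⊤ : ℕ∞) σ
  smooth_κ : ContDiff ℝ (⊤ : ℕ∞) κ
  hqq : ∀ s, mink (q s) (q s) = 1
  hhh : ∀ s, mink (h s) (h s) = -1
  haa : ∀ s, mink (a s) (a s) = 1
  hqh : ∀ s, mink (q s) (h s) = 0
  hqa : ∀ s, mink (q s) (a s) = 0
  hha : ∀ s, mink (h s) (a s) = 0
  σ_pos : ∀ s, 0 < σ s
  frenet_q : ∀ s, deriv q s = σ s • h s
  frenet_h : ∀ s, deriv h s = σ s • (q s + κ s • a s)
  frenet_a : ∀ s, deriv a s = (σ s * κ s) • h s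

/-- The Gram determinant identity for the Minkowski form. -/
theorem det3_sq_eq_neg_gram (u v w : Fin 3 → ℝ) :
    det3 u v w ^ 2 =
      -(mink u u * (mink v v * mink w w - mink v w ^ 2)
        - mink u v * (mink u v * mink w w - mink v w * mink u w)
        + mink u w * (mink u v * mink v w - mink v v * mink u w)) := by
  simp only [det3, mink]
  ring

theorem mink_comm (x y : Fin 3 → ℝ) : mink x y = mink y x := by
  simp only [mink]
  ring

theorem FrenetFrameM2.det3_sq (F : FrenetFrameM2) (s : ℝ) :
    det3 (F.q s) (F.a s) (F.h s) ^ 2 = 1 := by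
  rw [det3_sq_eq_neg_gram, mink_comm (F.a s) (F.h s), F.hqq, F.hhh, F.haa, F.hqh, F.hqa, F.hha]
  norm_num

theorem det3_add_smul_smul (u v w : Fin 3 → ℝ) (r t : ℝ) :
    det3 (u + r • w) v (t • w) = t * det3 u v w := by
  simp only [det3, Pi.add_apply, Pi.smul_apply, smul_eq_mul]
  ring

/-- Corollary 5.4 (a) (equation (37)): the trajectory surface φ_{h*}(s,v) = c*(s) + v a(s)
generated by the central normal h* = a of a Mannheim offset is nondevelopable, even
though φ is developable. -/
theorem trajectory_surface_h_nondevelopable (F : FrenetFrameM2)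
    (c : ℝ → Fin 3 → ℝ) (hc : ContDiff ℝ (⊤ : ℕ∞) c)
    (hcq : ∀ s, deriv c s = F.q s)
    (R : ℝ) (hκ : ∀ s, F.κ s ≠ 0) :
    ∀ s, det3 (deriv (fun t => c t + R • F.a t) s) (F.a s) (deriv F.a s) ≠ 0 := by
  intro s
  have hderiv : deriv (fun t => c t + R • F.a t) s
      = F.q s + (R * (F.σ s * F.κ s)) • F.h s := by
    have hc' : HasDerivAt c (F.q s) s :=
      hcq s ▸ (hc.differentiable (by simp) s).hasDerivAt
    have ha' : HasDerivAt F.a ((F.σ s * F.κ s) • F.h s) s :=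
      F.frenet_a s ▸ (F.smooth_a.differentiable (by simp) s).hasDerivAt
    rw [mul_smul]
    exact (hc'.add (ha'.const_smul R)).deriv
  rw [hderiv, F.frenet_a, det3_add_smul_smul]
  refine mul_ne_zero (mul_ne_zero (F.σ_pos s).ne' (hκ s)) fun h0 => ?_
  simpa [h0] using F.det3_sq s
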